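/- Let X be a finite set, μ a probability measure on X, ν a probability measure on X × X, and θ > 0, such that for all S, T ⊆ X with μ(S) ≥ 1/2 and μ(T) ≥ 1/2 one has ν(S × T) > θ. For 0 ≤ i < b let C_i ⊆ X × X; call index i blocked if ν(C_i) ≥ θ and unblocked otherwise. Define S_0 = X and, for 0 ≤ i < b, S_{i+1} = S_i if i is blocked, and S_{i+1} = {y ∈ X : there exists x ∈ S_i with (x, y) ∉ C_i} if i is unblocked. Then μ(S_i) ≥ 1/2 for all 0 ≤ i ≤ b; in particular S_b ≠ ∅. Consequently, in the graph D^E with X = (ZMod r)^R, μ the uniform measure, and with the short edges {v^i_x, v^{i+1}_y} with (x,y) ∈ C_i removed, there is a path from s to t of length at most 2 + a·b' + (b − b'), where b' is the number of blocked indices. -/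

import Mathlib

open Classical

/-- The hypercube `X = (ZMod r)^R`. -/
abbrev Cube (r R : ℕ) := Fin R → ZMod r

/-- Vertices of the Short-Path-Edge-Cut dictatorship test `D^E`:
`s`, `t`, and `v^i_x` for `0 ≤ i ≤ b` and `x ∈ (ZMod r)^R`. -/
inductive EV (r R : ℕ) where
  | s | t
  | v (i : ℕ) (x : Cube r R)

/-- The sets `S_i` of the soundness induction: `S_0 = X`; `S_{i+1} = S_i` if layer `i`
is blocked (`ν(C_i) ≥ θ`), and `S_{i+1} = {y : ∃ x ∈ S_i, (x, y) ∉ C_i}` otherwise. -/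
noncomputable def sS (r R : ℕ) [NeZero r] (θ : ℝ)
    (wν : Cube r R × Cube r R → ℝ) (C : ℕ → Finset (Cube r R × Cube r R)) :
    ℕ → Finset (Cube r R)
  | 0 => Finset.univ
  | (i + 1) =>
      if θ ≤ ∑ p ∈ C i, wν p then sS r R θ wν C i
      else Finset.univ.filter fun y => ∃ x ∈ sS r R θ wν C i, (x, y) ∉ C i

/-- Adjacency-with-length of `D^E` after removing, in each layer `i`, the short edges
`{v^i_x, v^{i+1}_y}` with `(x, y) ∈ C i`.  Edges `{s, v^0_x}` and `{v^b_x, t}` have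
length `1`, long edges `{v^i_x, v^{i+1}_x}` have length `a`, and the surviving short
edges have length `1`. -/
def sAdj (a b : ℕ) {r R : ℕ} (C : ℕ → Finset (Cube r R × Cube r R)) :
    EV r R → EV r R → ℕ → Prop
  | .s, .v i _, n => i = 0 ∧ n = 1
  | .v i _, .t, n => i = b ∧ n = 1
  | .v i x, .v j y, n => j = i + 1 ∧ i < b ∧ ((y = x ∧ n = a) ∨ (n = 1 ∧ (x, y) ∉ C i))
  | _, _, _ => False

/-- If `μ(S_i) ≥ 1/2`, then the expansion hypothesis forces `μ(S_{i+1}) ≥ 1/2`: in an unblocked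
layer the complement of `S_{i+1}` spans with `S_i` only pairs of `C_i`. -/
theorem half_le_sS (r R : ℕ) [NeZero r] (θ : ℝ)
    (wν : Cube r R × Cube r R → ℝ) (hν0 : ∀ p, 0 ≤ wν p)
    (hexp : ∀ S T : Finset (Cube r R),
      (1 : ℝ) / 2 ≤ (S.card : ℝ) / (Fintype.card (Cube r R)) →
      (1 : ℝ) / 2 ≤ (T.card : ℝ) / (Fintype.card (Cube r R)) →
      θ < ∑ p ∈ S ×ˢ T, wν p)
    (C : ℕ → Finset (Cube r R × Cube r R)) (i : ℕ) :
    (1 : ℝ) / 2 ≤ ((sS r R θ wν C i).card : ℝ) / Fintype.card (Cube r R) := by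
  have hcard : (0 : ℝ) < Fintype.card (Cube r R) := by exact_mod_cast Fintype.card_pos
  induction i with
  | zero =>
    rw [sS, Finset.card_univ, div_self hcard.ne']
    norm_num
  | succ i ih =>
    by_cases hblocked : θ ≤ ∑ p ∈ C i, wν p
    · rwa [sS, if_pos hblocked]
    by_contra! hlt
    refine hblocked ((hexp _ (sS r R θ wν C (i + 1))ᶜ ih ?_).le.trans
      (Finset.sum_le_sum_of_subset_of_nonneg ?_ fun p _ _ => hν0 p))
    · rw [Finset.card_compl, Nat.cast_sub (Finset.card_le_univ _), sub_div, div_self hcard.ne']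
      linarith
    · rintro ⟨x, y⟩ hxy
      obtain ⟨hx, hy⟩ := Finset.mem_product.1 hxy
      by_contra hC
      refine Finset.mem_compl.1 hy ?_
      rw [sS, if_neg hblocked]
      exact Finset.mem_filter.2 ⟨Finset.mem_univ _, x, hx, hC⟩

/-- Every `y ∈ S_k` is the endpoint of a surviving path through layers `0, …, k` that uses a long
edge exactly in the blocked layers. -/
theorem exists_layered_path (a b r R : ℕ) [NeZero r] (θ : ℝ)
    (wν : Cube r R × Cube r R → ℝ) (C : ℕ → Finset (Cube r R × Cube r R))
    (k : ℕ) (hk : k ≤ b) (y : Cube r R) (hy : y ∈ sS r R θ wν C k) :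
    ∃ x : ℕ → Cube r R, x k = y ∧ ∀ i < k,
      sAdj a b C (.v i (x i)) (.v (i + 1) (x (i + 1)))
        (if θ ≤ ∑ p ∈ C i, wν p then a else 1) := by
  induction k generalizing y with
  | zero => exact ⟨fun _ => y, rfl, fun i hi => absurd hi i.not_lt_zero⟩
  | succ k ih =>
    obtain ⟨z, hz, hedge⟩ : ∃ z ∈ sS r R θ wν C k,
        sAdj a b C (.v k z) (.v (k + 1) y) (if θ ≤ ∑ p ∈ C k, wν p then a else 1) := by
      by_cases hblocked : θ ≤ ∑ p ∈ C k, wν p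
      · rw [sS, if_pos hblocked] at hy
        exact ⟨y, hy, rfl, hk, Or.inl ⟨rfl, if_pos hblocked⟩⟩
      · rw [sS, if_neg hblocked] at hy
        obtain ⟨z, hz, hC⟩ := (Finset.mem_filter.1 hy).2
        exact ⟨z, hz, rfl, hk, Or.inr ⟨if_neg hblocked, hC⟩⟩
    obtain ⟨x, rfl, hx⟩ := ih (by omega) z hz
    refine ⟨Function.update x (k + 1) y, Function.update_self .., fun i hi => ?_⟩
    rw [Function.update_of_ne hi.ne]
    obtain hik | rfl := Nat.lt_succ_iff_lt_or_eq.1 hi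
    · rw [Function.update_of_ne (by omega)]
      exact hx i hik
    · rwa [Function.update_self]

/-- A surviving path through layers `0, …, b` extends to a path from `s` to `t` that is longer
by `2`. -/
theorem exists_path_of_layered (a b : ℕ) {r R : ℕ} (C : ℕ → Finset (Cube r R × Cube r R))
    (x : ℕ → Cube r R) (l : ℕ → ℕ)
    (hx : ∀ i < b, sAdj a b C (.v i (x i)) (.v (i + 1) (x (i + 1))) (l i)) :
    ∃ (n : ℕ) (p : Fin (n + 1) → EV r R) (ℓ : Fin n → ℕ),
      p 0 = EV.s ∧ p (Fin.last n) = EV.t ∧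
      (∀ j : Fin n, sAdj a b C (p j.castSucc) (p j.succ) (ℓ j)) ∧
      ∑ j, ℓ j = 2 + ∑ i ∈ Finset.range b, l i := by
  let p : ℕ → EV r R
    | 0 => .s
    | j + 1 => if j ≤ b then .v j (x j) else .t
  let ℓ : ℕ → ℕ
    | 0 => 1
    | j + 1 => if j < b then l j else 1
  refine ⟨b + 2, fun j => p j, fun j => ℓ j, rfl, if_neg (by simp), fun ⟨j, hj⟩ => ?_, ?_⟩
  · change sAdj a b C (p j) (p (j + 1)) (ℓ j)
    cases j with
    | zero => simp [p, ℓ, sAdj]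
    | succ j =>
      obtain hjb | rfl : j < b ∨ j = b := by omega
      · simpa [p, ℓ, hjb, hjb.le, Nat.succ_le_of_lt hjb] using hx j hjb
      · simp [p, ℓ, sAdj]
  · rw [Fin.sum_univ_eq_sum_range, Finset.sum_range_succ', Finset.sum_range_succ,
      Finset.sum_congr rfl fun i hi => if_pos (Finset.mem_range.1 hi)]
    simp only [ℓ, lt_irrefl, if_false]
    ring

/-- Soundness of the `D^E` dictatorship test: if `μ` is the uniform measure on
`X = (ZMod r)^R`, `ν` a probability measure on `X × X`, and `θ > 0` are such that any
two sets of `μ`-measure `≥ 1/2` span `ν`-measure `> θ`, then `μ(S_i) ≥ 1/2` for all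
`i ≤ b`, so `S_b ≠ ∅`; consequently, after removing the short edges of `C_i` in every
layer `i`, there is still a path from `s` to `t` of total length at most
`2 + a·b' + (b - b')`, where `b'` is the number of blocked layers. -/
theorem stmt5 (a b r R : ℕ) [NeZero r] (ha : 1 ≤ a) (hb : 1 ≤ b) (hr : 2 ≤ r) (hR : 1 ≤ R)
    (θ : ℝ) (hθ : 0 < θ)
    (wν : Cube r R × Cube r R → ℝ) (hν0 : ∀ p, 0 ≤ wν p) (hν1 : ∑ p, wν p = 1)
    (hexp : ∀ S T : Finset (Cube r R),
      (1 : ℝ) / 2 ≤ (S.card : ℝ) / (Fintype.card (Cube r R)) →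
      (1 : ℝ) / 2 ≤ (T.card : ℝ) / (Fintype.card (Cube r R)) →
      θ < ∑ p ∈ S ×ˢ T, wν p)
    (C : ℕ → Finset (Cube r R × Cube r R))
    (b' : ℕ) (hb' : b' = ((Finset.range b).filter fun i => θ ≤ ∑ p ∈ C i, wν p).card) :
    (∀ i ≤ b, (1 : ℝ) / 2 ≤ ((sS r R θ wν C i).card : ℝ) / Fintype.card (Cube r R)) ∧
    (sS r R θ wν C b).Nonempty ∧
    ∃ (n : ℕ) (p : Fin (n + 1) → EV r R) (ℓ : Fin n → ℕ),
      p 0 = EV.s ∧ p (Fin.last n) = EV.t ∧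
      (∀ j : Fin n, sAdj a b C (p j.castSucc) (p j.succ) (ℓ j) ∨
        sAdj a b C (p j.succ) (p j.castSucc) (ℓ j)) ∧
      ∑ j, ℓ j ≤ 2 + a * b' + (b - b') := by
  have hhalf := half_le_sS r R θ wν hν0 hexp C
  have hne : (sS r R θ wν C b).Nonempty := by
    rw [Finset.nonempty_iff_ne_empty]
    intro hempty
    have := hhalf b
    norm_num [hempty] at this
  refine ⟨fun i _ => hhalf i, hne, ?_⟩
  obtain ⟨y, hy⟩ := hne
  obtain ⟨x, -, hx⟩ := exists_layered_path a b r R θ wν C b le_rfl y hy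
  obtain ⟨n, p, ℓ, hs, ht, hadj, hlen⟩ := exists_path_of_layered a b C x _ hx
  refine ⟨n, p, ℓ, hs, ht, fun j => Or.inl (hadj j), ?_⟩
  have hcount := Finset.card_filter_add_card_filter_not (s := Finset.range b)
    (fun i => θ ≤ ∑ p ∈ C i, wν p)
  rw [← hb', Finset.card_range] at hcount
  rw [hlen, Finset.sum_ite, Finset.sum_const, Finset.sum_const, ← hb', smul_eq_mul, smul_eq_mul,
    mul_one, mul_comm b' a]
  omega
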